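/- Let m ≥ 1 and N ≥ 1 be integers, let W_1,…,W_N be real symmetric positive semidefinite m×m matrices, let k_1,…,k_N be nonnegative reals, and let c ≥ 0. Then the supremum over all U ∈ ℝ^m with UᵀU ≤ c of min_{i∈{1,…,N}} (UᵀW_iU + k_i) is at most c · inf_{p ∈ Δ_N} λ_max(Σ_{i=1}^{N} p_i W_i) + max_{i∈{1,…,N}} k_i, where Δ_N := {p ∈ ℝ^N : p_i ≥ 0 for all i, Σ_i p_i = 1} is the standard simplex and λ_max denotes the largest eigenvalue of a real symmetric matrix. -/

import Mathlib

open Matrix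

/-- The largest eigenvalue of a real (symmetric) matrix. -/
noncomputable def lambdaMax {n : ℕ} (M : Matrix (Fin n) (Fin n) ℝ) : ℝ :=
  sSup {r : ℝ | ∃ v : Fin n → ℝ, v ≠ 0 ∧ M.mulVec v = r • v}

theorem bddAbove_setOf_eigenvalue {n : ℕ} (M : Matrix (Fin n) (Fin n) ℝ) :
    BddAbove {r : ℝ | ∃ v : Fin n → ℝ, v ≠ 0 ∧ M.mulVec v = r • v} := by
  refine ((Module.End.finite_hasEigenvalue M.toLin').subset ?_).bddAbove
  rintro r ⟨v, hv, hMv⟩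
  refine Module.End.hasEigenvalue_of_hasEigenvector (x := v) ⟨?_, hv⟩
  rw [Module.End.mem_eigenspace_iff, Matrix.toLin'_apply, hMv]

theorem posSemidef_lambdaMax_smul_one_sub {n : ℕ} {M : Matrix (Fin n) (Fin n) ℝ}
    (hM : M.IsHermitian) : (lambdaMax M • (1 : Matrix (Fin n) (Fin n) ℝ) - M).PosSemidef := by
  have hA : (lambdaMax M • (1 : Matrix (Fin n) (Fin n) ℝ) - M).IsHermitian := by
    refine IsHermitian.sub ?_ hM
    simp [IsHermitian]
  rw [hA.posSemidef_iff_eigenvalues_nonneg]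
  intro i
  have hv := hA.mulVec_eigenvectorBasis i
  rw [sub_mulVec, smul_mulVec, one_mulVec] at hv
  have hle : lambdaMax M - hA.eigenvalues i ≤ lambdaMax M := by
    refine le_csSup (bddAbove_setOf_eigenvalue M) ⟨⇑(hA.eigenvectorBasis i), ?_, ?_⟩
    · intro h0
      exact hA.eigenvectorBasis.toBasis.ne_zero i (by ext j; simpa using congrFun h0 j)
    · rw [sub_smul, ← hv, sub_sub_cancel]
  simpa using hle

theorem dotProduct_mulVec_le_lambdaMax_mul {n : ℕ} {M : Matrix (Fin n) (Fin n) ℝ}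
    (hM : M.IsHermitian) (u : Fin n → ℝ) :
    u ⬝ᵥ M.mulVec u ≤ lambdaMax M * (u ⬝ᵥ u) := by
  have h := (posSemidef_lambdaMax_smul_one_sub hM).dotProduct_mulVec_nonneg u
  simpa [sub_mulVec, smul_mulVec, dotProduct_sub] using h

theorem lambdaMax_nonneg {n : ℕ} {M : Matrix (Fin n) (Fin n) ℝ} (hM : M.PosSemidef) :
    0 ≤ lambdaMax M := by
  refine Real.sSup_nonneg ?_
  rintro r ⟨v, hv, hMv⟩
  have h := hM.dotProduct_mulVec_nonneg v
  have hpos : 0 < v ⬝ᵥ v := by simpa using dotProduct_star_self_pos_iff.mpr hv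
  rw [hMv, star_trivial, dotProduct_smul, smul_eq_mul] at h
  exact nonneg_of_mul_nonneg_left h hpos

/-- Matrix optimization bound from the proof of Theorem 1 of the paper: the optimal value of
`max_{UᵀU ≤ c} min_i (UᵀW_iU + k_i)` is at most
`c · inf_{p ∈ Δ_N} λ_max(Σ_i p_i W_i) + max_i k_i`. -/
theorem maxmin_upper_bound
    (m N : ℕ) (hm : 1 ≤ m) (hN : 1 ≤ N)
    (W : Fin N → Matrix (Fin m) (Fin m) ℝ) (hW : ∀ i, (W i).PosSemidef)
    (k : Fin N → ℝ) (hk : ∀ i, 0 ≤ k i) (c : ℝ) (hc : 0 ≤ c) :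
    ∀ U : Fin m → ℝ, U ⬝ᵥ U ≤ c →
      (⨅ i : Fin N, (U ⬝ᵥ (W i).mulVec U + k i)) ≤
        c * sInf {r : ℝ | ∃ p : Fin N → ℝ, (∀ i, 0 ≤ p i) ∧ (∑ i, p i) = 1 ∧
              r = lambdaMax (∑ i, p i • W i)}
          + ⨆ i : Fin N, k i := by
  intro U hU
  have : Nonempty (Fin N) := ⟨⟨0, hN⟩⟩
  rw [← sub_le_iff_le_add, ← smul_eq_mul, ← Real.sInf_smul_of_nonneg hc]
  refine le_csInf (Set.Nonempty.smul_set ⟨_, Pi.single ⟨0, hN⟩ 1, fun i => ?_, by simp, rfl⟩) ?_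
  · exact (Pi.single_nonneg.mpr zero_le_one : (0 : Fin N → ℝ) ≤ _) i
  rintro _ ⟨_, ⟨p, hp, hp1, rfl⟩, rfl⟩
  have hpsd : (∑ i, p i • W i).PosSemidef :=
    posSemidef_sum _ fun i _ => (hW i).smul (hp i)
  have hquad : ∑ i, p i * (U ⬝ᵥ (W i).mulVec U) ≤ c * lambdaMax (∑ i, p i • W i) := by
    calc ∑ i, p i * (U ⬝ᵥ (W i).mulVec U)
        = U ⬝ᵥ (∑ i, p i • W i).mulVec U := by
          simp [sum_mulVec, dotProduct_sum, smul_mulVec]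
      _ ≤ lambdaMax (∑ i, p i • W i) * (U ⬝ᵥ U) :=
          dotProduct_mulVec_le_lambdaMax_mul hpsd.isHermitian U
      _ ≤ c * lambdaMax (∑ i, p i • W i) := by
          rw [mul_comm c]
          exact mul_le_mul_of_nonneg_left hU (lambdaMax_nonneg hpsd)
  have hmin : (⨅ i, (U ⬝ᵥ (W i).mulVec U + k i)) ≤
      ∑ i, p i * (U ⬝ᵥ (W i).mulVec U + ⨆ i, k i) := by
    rw [← one_mul (⨅ i, _), ← hp1, Finset.sum_mul]
    refine Finset.sum_le_sum fun i _ => mul_le_mul_of_nonneg_left ?_ (hp i)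
    exact (ciInf_le (Set.finite_range _).bddBelow i).trans
      (by gcongr; exact le_ciSup (Set.finite_range k).bddAbove i)
  simp only [mul_add, Finset.sum_add_distrib, ← Finset.sum_mul, hp1, one_mul] at hmin
  simp only [smul_eq_mul]
  linarith
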